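/- arXiv:1001.0498 — 3 statements merged into one kernel-verified Lean document; each statement's English description precedes it below -/
import Mathlib

section
/- Let L : ℝ^d → ℝ be strictly convex, differentiable, and of superlinear growth, and let (H_i, p_i) ∈ ℝ × ℝ^d, i = 1, …, k (k ≥ 1). If v* is a global minimum point of L̂(v) = max_{1≤i≤k} (L(v) + H_i − ⟨p_i, v⟩), then the gradient ∇L(v*) belongs to the convex hull of the set {p_j : j ∈ I(v*)}, where I(v*) = {j : L(v*) + H_j − ⟨p_j, v*⟩ = L̂(v*)} is the set of active indices at v*; i.e., v* is admissible. -/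
open scoped RealInnerProductSpace

/-- `Lhat L H p v = max_i (L v + H i - ⟪p i, v⟫)`. -/
noncomputable def Lhat {d : ℕ} {ι : Type} [Fintype ι] [Nonempty ι]
    (L : EuclideanSpace ℝ (Fin d) → ℝ) (H : ι → ℝ)
    (p : ι → EuclideanSpace ℝ (Fin d)) (v : EuclideanSpace ℝ (Fin d)) : ℝ :=
  Finset.univ.sup' Finset.univ_nonempty fun i => L v + H i - ⟪p i, v⟫

open scoped Topology

/-- A function with negative directional derivative takes strictly smaller values a little further
along that direction. -/
theorem HasDerivAt.eventually_lt_of_neg {f : ℝ → ℝ} {f' x : ℝ} (hf : HasDerivAt f f' x)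
    (hf' : f' < 0) : ∀ᶠ t in 𝓝[>] (0 : ℝ), f (x + t) < f x := by
  filter_upwards [hf.tendsto_slope_zero_right.eventually_lt_const hf', self_mem_nhdsWithin]
    with t ht htpos
  have hinv : 0 < t⁻¹ := inv_pos.mpr htpos
  rw [smul_eq_mul] at ht
  exact sub_neg.mp (neg_of_mul_neg_right ht hinv.le)

/-- A point outside the convex hull of a finite set is strictly separated from all points of the
set by some direction. -/
theorem exists_inner_lt_of_notMem_convexHull {E : Type*} [NormedAddCommGroup E]
    [InnerProductSpace ℝ E] [CompleteSpace E] {s : Set E} (hs : s.Finite) {g : E}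
    (hg : g ∉ convexHull ℝ s) : ∃ w : E, ∀ x ∈ s, ⟪g, w⟫ < ⟪x, w⟫ := by
  obtain ⟨f, u, hfg, hfs⟩ := geometric_hahn_banach_point_closed (convex_convexHull ℝ s)
    (hs.isClosed_convexHull ℝ) hg
  refine ⟨(InnerProductSpace.toDual ℝ E).symm f, fun x hx => ?_⟩
  rw [real_inner_comm, real_inner_comm _ x, InnerProductSpace.toDual_symm_apply,
    InnerProductSpace.toDual_symm_apply]
  exact hfg.trans (hfs x (subset_convexHull ℝ s hx))

/-- any global minimum point `v*` of `L̂` is admissible: the gradient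
`∇L(v*)` lies in the convex hull of the active momenta `{p j : j ∈ I(v*)}`. -/
theorem min_of_lhat_is_admissible {d : ℕ} (hd : 1 ≤ d) {ι : Type} [Fintype ι] [Nonempty ι]
    (L : EuclideanSpace ℝ (Fin d) → ℝ)
    (hconv : StrictConvexOn ℝ Set.univ L)
    (hdiff : Differentiable ℝ L)
    (hsuper : Filter.Tendsto (fun (v : EuclideanSpace ℝ (Fin d)) => L v / ‖v‖)
      (Filter.comap (fun (v : EuclideanSpace ℝ (Fin d)) => ‖v‖) Filter.atTop) Filter.atTop)
    (H : ι → ℝ) (p : ι → EuclideanSpace ℝ (Fin d))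
    (vstar : EuclideanSpace ℝ (Fin d))
    (hmin : ∀ v, Lhat L H p vstar ≤ Lhat L H p v) :
    gradient L vstar ∈ convexHull ℝ
      (p '' {j | L vstar + H j - ⟪p j, vstar⟫ = Lhat L H p vstar}) := by
  by_contra hg
  obtain ⟨w, hw⟩ := exists_inner_lt_of_notMem_convexHull (Set.toFinite _) hg
  have hderiv : ∀ i, HasDerivAt
      (fun t : ℝ => L (vstar + t • w) + H i - ⟪p i, vstar + t • w⟫)
      (⟪gradient L vstar, w⟫ - ⟪p i, w⟫) 0 := by
    intro i
    have hline : HasDerivAt (fun t : ℝ => vstar + t • w) w 0 := by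
      simpa using ((hasDerivAt_id (0 : ℝ)).smul_const w).const_add vstar
    have hL : HasFDerivAt L (InnerProductSpace.toDual ℝ _ (gradient L vstar))
        (vstar + (0 : ℝ) • w) := by
      simpa using (hdiff vstar).hasGradientAt.hasFDerivAt
    have hp := (innerSL ℝ (p i)).hasFDerivAt.comp_hasDerivAt (0 : ℝ) hline
    exact ((hL.comp_hasDerivAt (0 : ℝ) hline).add_const (H i)).sub hp
  have hev : ∀ i, ∀ᶠ t in 𝓝[>] (0 : ℝ),
      L (vstar + t • w) + H i - ⟪p i, vstar + t • w⟫ < Lhat L H p vstar := by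
    intro i
    have hle : L vstar + H i - ⟪p i, vstar⟫ ≤ Lhat L H p vstar :=
      Finset.le_sup' (fun i => L vstar + H i - ⟪p i, vstar⟫) (Finset.mem_univ i)
    rcases hle.eq_or_lt with hactive | hinactive
    · have hneg := (hderiv i).eventually_lt_of_neg
        (sub_neg.mpr (hw _ (Set.mem_image_of_mem p hactive)))
      simpa [hactive] using hneg
    · have hcont := (hderiv i).continuousAt.eventually_lt_const
        (show L (vstar + (0 : ℝ) • w) + H i - ⟪p i, vstar + (0 : ℝ) • w⟫ < Lhat L H p vstar by
          simpa using hinactive)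
      exact nhdsWithin_le_nhds hcont
  obtain ⟨t, ht⟩ := (Filter.eventually_all.mpr hev).exists
  exact (hmin (vstar + t • w)).not_gt
    ((Finset.sup'_lt_iff Finset.univ_nonempty).mpr fun i _ => ht i)
end

section
/- Let L : ℝ^d → ℝ be strictly convex and differentiable, and let (H_i, p_i) ∈ ℝ × ℝ^d, i = 1, …, k (k ≥ 1). If v̂ ∈ ℝ^d is admissible, i.e. ∇L(v̂) = Σ_{j ∈ I(v̂)} λ_j p_j for some coefficients λ_j ≥ 0 with Σ_{j ∈ I(v̂)} λ_j = 1, then v̂ is the unique global minimum point of L̂: for every h ≠ 0 one has L̂(v̂ + h) > L̂(v̂). -/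
open scoped RealInnerProductSpace

/-- A strictly convex function lies strictly above its tangent hyperplanes, away from the point of
tangency. -/
theorem StrictConvexOn.add_inner_gradient_lt {E : Type*} [NormedAddCommGroup E]
    [InnerProductSpace ℝ E] [CompleteSpace E] {f : E → ℝ} (hf : StrictConvexOn ℝ Set.univ f)
    {x h : E} (hdiff : DifferentiableAt ℝ f x) (hh : h ≠ 0) :
    f x + ⟪gradient f x, h⟫ < f (x + h) := by
  have hline : StrictConvexOn ℝ Set.univ fun t : ℝ => f (x + t • h) := by
    refine ⟨convex_univ, fun s _ t _ hst a b ha hb hab => ?_⟩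
    have hne : x + s • h ≠ x + t • h := fun e =>
      hst (smul_left_injective ℝ hh (add_left_cancel e))
    have hcomb : x + (a • s + b • t) • h = a • (x + s • h) + b • (x + t • h) := by
      obtain rfl : b = 1 - a := by linarith
      simp only [smul_eq_mul]
      module
    simpa only [hcomb] using hf.2 (Set.mem_univ _) (Set.mem_univ _) hne ha hb hab
  have hderiv : HasDerivAt (fun t : ℝ => f (x + t • h)) ⟪gradient f x, h⟫ 0 := by
    simpa [HasLineDerivAt] using
      hdiff.hasGradientAt.hasFDerivAt.hasLineDerivAt h
  have hslope := hline.lt_slope_of_hasDerivAt (Set.mem_univ 0) (Set.mem_univ 1) one_pos hderiv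
  simp only [slope_def_field, zero_smul, one_smul, add_zero, sub_zero, div_one] at hslope
  linarith

/-- if `v̂` is admissible, i.e. `∇L(v̂)` is a convex combination
`Σ_{j ∈ I(v̂)} λ_j p_j` of the active momenta (the coefficients `λ` vanish off the
active set `I(v̂)`), then `v̂` is the unique global minimum point of `L̂`. -/
theorem admissible_is_unique_min {d : ℕ} (hd : 1 ≤ d) {ι : Type} [Fintype ι] [Nonempty ι]
    (L : EuclideanSpace ℝ (Fin d) → ℝ)
    (hconv : StrictConvexOn ℝ Set.univ L)
    (hdiff : Differentiable ℝ L)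
    (H : ι → ℝ) (p : ι → EuclideanSpace ℝ (Fin d))
    (vhat : EuclideanSpace ℝ (Fin d))
    (lam : ι → ℝ)
    (hlam_nonneg : ∀ j, 0 ≤ lam j)
    (hlam_active : ∀ j, lam j ≠ 0 → L vhat + H j - ⟪p j, vhat⟫ = Lhat L H p vhat)
    (hlam_sum : ∑ j, lam j = 1)
    (hgrad : gradient L vhat = ∑ j, lam j • p j) :
    ∀ h : EuclideanSpace ℝ (Fin d), h ≠ 0 →
      Lhat L H p vhat < Lhat L H p (vhat + h) := by
  intro h hh
  have htangent := hconv.add_inner_gradient_lt (hdiff vhat) hh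
  have hle : ∀ j, L (vhat + h) + H j - ⟪p j, vhat + h⟫ ≤ Lhat L H p (vhat + h) := fun j =>
    Finset.le_sup' (fun i => L (vhat + h) + H i - ⟪p i, vhat + h⟫) (Finset.mem_univ j)
  have hterm : ∀ j, lam j * (Lhat L H p vhat + (L (vhat + h) - L vhat) - ⟪p j, h⟫) ≤
      lam j * Lhat L H p (vhat + h) := by
    intro j
    rcases eq_or_ne (lam j) 0 with hj | hj
    · simp [hj]
    · refine mul_le_mul_of_nonneg_left ?_ (hlam_nonneg j)
      have hactive := hlam_active j hj
      have hlej := hle j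
      rw [inner_add_right] at hlej
      linarith
  have hsum := Finset.sum_le_sum fun j (_ : j ∈ Finset.univ) => hterm j
  have hinner : ⟪gradient L vhat, h⟫ = ∑ j, lam j * ⟪p j, h⟫ := by
    simp only [hgrad, sum_inner, real_inner_smul_left]
  simp only [mul_sub (lam _) (_ + _), Finset.sum_sub_distrib, ← Finset.sum_mul, hlam_sum,
    one_mul, ← hinner] at hsum
  linarith
end

section
/- Define f : [0, ∞) × ℝ → ℝ by f(τ, ξ) = −(4/3)τ³ − 2|ξ|τ − (4/3)(|ξ| + τ²)^{3/2}. Then f(0, ξ) = −(4/3)|ξ|^{3/2} for all ξ, and at every point (τ, ξ) with τ > 0 and ξ ≠ 0 the function f is differentiable and satisfies the Hamilton–Jacobi equation ∂f/∂τ (τ, ξ) + (1/2)(∂f/∂ξ (τ, ξ))² = 0. -/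
/-- `f(τ, ξ) = -(4/3)τ³ - 2|ξ|τ - (4/3)(|ξ| + τ²)^{3/2}` (the local model of a
viscosity solution near a preshock). -/
noncomputable def preshock (τ ξ : ℝ) : ℝ :=
  -(4 / 3) * τ ^ 3 - 2 * |ξ| * τ - (4 / 3) * (|ξ| + τ ^ 2) ^ ((3 : ℝ) / 2)

theorem hasDerivAt_preshock_fst {τ ξ : ℝ} (hξ : ξ ≠ 0) :
    HasDerivAt (fun s => preshock s ξ)
      (-4 * τ ^ 2 - 2 * |ξ| - 4 * τ * √(|ξ| + τ ^ 2)) τ := by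
  have hpos : 0 < |ξ| + τ ^ 2 := by positivity
  have hsq : HasDerivAt (fun s : ℝ => |ξ| + s ^ 2) (2 * τ) τ := by
    simpa using (hasDerivAt_pow 2 τ).const_add |ξ|
  have h := (((hasDerivAt_pow 3 τ).const_mul (-(4 / 3) : ℝ)).sub
    ((hasDerivAt_id τ).const_mul (2 * |ξ|))).sub
    ((hsq.rpow_const (p := 3 / 2) (Or.inl hpos.ne')).const_mul (4 / 3 : ℝ))
  refine h.congr_deriv ?_
  rw [Real.sqrt_eq_rpow, show (3 / 2 - 1 : ℝ) = 1 / 2 by norm_num]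
  push_cast
  ring

theorem hasDerivAt_preshock_snd {τ ξ : ℝ} (hξ : ξ ≠ 0) :
    HasDerivAt (fun y => preshock τ y)
      (-2 * (SignType.sign ξ : ℝ) * (τ + √(|ξ| + τ ^ 2))) ξ := by
  have hpos : 0 < |ξ| + τ ^ 2 := by positivity
  have habs := hasDerivAt_abs hξ
  have h := (((habs.const_mul (2 : ℝ)).mul_const τ).const_sub (-(4 / 3) * τ ^ 3)).sub
    (((habs.add_const (τ ^ 2)).rpow_const (p := 3 / 2) (Or.inl hpos.ne')).const_mul (4 / 3 : ℝ))
  refine h.congr_deriv ?_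
  rw [Real.sqrt_eq_rpow, show (3 / 2 - 1 : ℝ) = 1 / 2 by norm_num]
  ring

theorem differentiableAt_preshock {τ ξ : ℝ} (hξ : ξ ≠ 0) :
    DifferentiableAt ℝ (fun q : ℝ × ℝ => preshock q.1 q.2) (τ, ξ) := by
  have hpos : 0 < |ξ| + τ ^ 2 := by positivity
  have habs : DifferentiableAt ℝ (fun q : ℝ × ℝ => |q.2|) (τ, ξ) :=
    differentiableAt_snd.abs hξ
  have hrpow : DifferentiableAt ℝ
      (fun q : ℝ × ℝ => (|q.2| + q.1 ^ 2) ^ ((3 : ℝ) / 2)) (τ, ξ) :=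
    (habs.add (differentiableAt_fst.pow 2)).rpow_const (Or.inl hpos.ne')
  unfold preshock
  fun_prop

/-- `f(0, ξ) = -(4/3)|ξ|^{3/2}`, and for `τ > 0`, `ξ ≠ 0` the function
`f` is differentiable and satisfies the Hamilton–Jacobi equation
`∂f/∂τ + (1/2)(∂f/∂ξ)² = 0`. -/
theorem preshock_weak_solution :
    (∀ ξ : ℝ, preshock 0 ξ = -(4 / 3) * |ξ| ^ ((3 : ℝ) / 2)) ∧
    (∀ τ ξ : ℝ, 0 < τ → ξ ≠ 0 →
      DifferentiableAt ℝ (fun q : ℝ × ℝ => preshock q.1 q.2) (τ, ξ) ∧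
      deriv (fun s => preshock s ξ) τ
        + (1 / 2) * (deriv (fun y => preshock τ y) ξ) ^ 2 = 0) := by
  refine ⟨fun ξ => by simp [preshock], fun τ ξ _ hξ => ⟨differentiableAt_preshock hξ, ?_⟩⟩
  rw [(hasDerivAt_preshock_fst hξ).deriv, (hasDerivAt_preshock_snd hξ).deriv]
  have hS : √(|ξ| + τ ^ 2) ^ 2 = |ξ| + τ ^ 2 := Real.sq_sqrt (by positivity)
  have hsign : (SignType.sign ξ : ℝ) ^ 2 = 1 := by
    rcases lt_or_gt_of_ne hξ with h | h <;> simp [h]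
  linear_combination 2 * (τ + √(|ξ| + τ ^ 2)) ^ 2 * hsign + 2 * hS
end
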